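/- Let P be a countable poset, Q a lower subset of P which has a finite foundation, and I a subset of P such that I ∩ P_min ⊆ Q. Then: (Existence) there is an ω-Stone space W with a trim P-partition 𝒳 = {X_p | p ∈ P} such that (i) ⋃_{q∈Q} X_q is contained in a compact subset of W, (ii) the closure of X_p is non-compact for every p ∉ Q, and (iii) 𝒳 is I-isolated. (Uniqueness) If W and W' are ω-Stone spaces with trim P-partitions 𝒳 and 𝒳' each satisfying (i)–(iii), then there is a homeomorphism from W to W' carrying X_p onto X'_p for every p ∈ P. -/

import Mathlib

open Set

variable {P W : Type*} [PartialOrder P] [TopologicalSpace W]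

/-- The type of a subset `Y` with respect to the family `X`. -/
def ptype (X : P → Set W) (Y : Set W) : Set P :=
  {p | (Y ∩ X p).Nonempty}

/-- `A` is a `p`-trim set: a compact open set whose type is exactly `{q | p ≤ q}`. -/
def IsTrimSet (X : P → Set W) (p : P) (A : Set W) : Prop :=
  IsCompact A ∧ IsOpen A ∧ ptype X A = Ici p

/-- `P̂`: the set of labels `p` for which a `p`-trim set exists. -/
def trimHat (X : P → Set W) : Set P :=
  {p | ∃ A, IsTrimSet X p A}

/-- A `P`-partition: a pairwise disjoint family of nonempty subsets. -/
structure IsPPartition (X : P → Set W) : Prop where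
  nonempty : ∀ p, (X p).Nonempty
  pairwise_disjoint : Pairwise fun p q => Disjoint (X p) (X q)

/-- A semi-trim `P`-partition. -/
structure IsSemiTrim (X : P → Set W) extends IsPPartition X : Prop where
  nhds_base : ∀ w : W, ∀ U ∈ nhds w, ∃ p A, IsTrimSet X p A ∧ w ∈ A ∧ A ⊆ U
  trim_dense : ∀ A : Set W, IsOpen A → ∀ p ∈ ptype X A ∩ trimHat X,
    ∃ B ⊆ A, IsTrimSet X p B
  label_sup : ∀ p, ∀ x ∈ X p, IsLUB {q | ∃ A, IsTrimSet X q A ∧ x ∈ A} p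
  full : ∀ p : P, ∀ w : W,
    (∀ U ∈ nhds w, ∃ A, IsTrimSet X p A ∧ w ∈ A ∧ A ⊆ U) → w ∈ X p

/-- A trim `P`-partition: every point of `W` has a neighbourhood base of trim sets, every
point of `X p` has a `p`-trim neighbourhood, and the partition is full. -/
def IsTrimPartition (X : P → Set W) : Prop :=
  IsPPartition X ∧
  (∀ w : W, ∀ U ∈ nhds w, ∃ p A, IsTrimSet X p A ∧ w ∈ A ∧ A ⊆ U) ∧
  (∀ p, ∀ x ∈ X p, ∃ A, IsTrimSet X p A ∧ x ∈ A) ∧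
  (∀ p : P, ∀ w : W,
    (∀ U ∈ nhds w, ∃ A, IsTrimSet X p A ∧ w ∈ A ∧ A ⊆ U) → w ∈ X p)

/-- The partition `X` is `I`-isolated: `X p` has no isolated points for `p ∉ I`, every point
of `X p` is isolated in `X p` for `p ∈ I`, and `X p` is a singleton for minimal `p ∈ I`. -/
def IsIsolatedFamily (I : Set P) (X : P → Set W) : Prop :=
  (∀ p ∉ I, ∀ x ∈ X p, ¬ ∃ U : Set W, IsOpen U ∧ U ∩ X p = {x}) ∧
  (∀ p ∈ I, ∀ x ∈ X p, ∃ U : Set W, IsOpen U ∧ U ∩ X p = {x}) ∧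
  (∀ p ∈ I, IsMin p → ∃ x : W, X p = {x})

/-- The data required of the partition in Statement 18: a trim `P`-partition such that
(i) `⋃_{q ∈ Q} X q` is contained in a compact set, (ii) `closure (X p)` is non-compact for
`p ∉ Q`, and (iii) the partition is `I`-isolated. -/
def Stmt18Partition (Q I : Set P) (X : P → Set W) : Prop :=
  IsTrimPartition X ∧
  (∃ K : Set W, IsCompact K ∧ (⋃ q ∈ Q, X q) ⊆ K) ∧
  (∀ p ∉ Q, ¬ IsCompact (closure (X p))) ∧
  IsIsolatedFamily I X

/-- A second countable Stone space (ω-Stone space). -/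
def IsOmegaStone (W : Type) [TopologicalSpace W] : Prop :=
  LocallyCompactSpace W ∧ TotallyDisconnectedSpace W ∧ T2Space W ∧
    SecondCountableTopology W

open TopologicalSpace

set_option linter.unusedSectionVars false

section TrimPartition

variable {X : P → Set W} {I : Set P}

theorem ptype_mono (X : P → Set W) {A B : Set W} (h : A ⊆ B) : ptype X A ⊆ ptype X B :=
  fun _ hp => hp.mono (inter_subset_inter_left _ h)

theorem mem_ptype_iff_encard_ne_zero {p : P} {A : Set W} :
    p ∈ ptype X A ↔ (A ∩ X p).encard ≠ 0 := by
  rw [ptype, mem_ofPred_eq, encard_ne_zero]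

theorem IsTrimSet.mem_ptype {p : P} {A : Set W} (hA : IsTrimSet X p A) : p ∈ ptype X A := by
  rw [hA.2.2]; exact mem_Ici.2 le_rfl

namespace IsTrimPartition

theorem exists_trim_subset (hX : IsTrimPartition X) {U : Set W} (hU : IsOpen U) {p : P} {x : W}
    (hxU : x ∈ U) (hxp : x ∈ X p) : ∃ A, IsTrimSet X p A ∧ x ∈ A ∧ A ⊆ U := by
  obtain ⟨A, hA, hxA⟩ := hX.2.2.1 p x hxp
  obtain ⟨q, B, hB, hxB, hBU⟩ := hX.2.1 x (U ∩ A) ((hU.inter hA.2.1).mem_nhds ⟨hxU, hxA⟩)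
  have hpq : q ≤ p := by
    have : p ∈ ptype X B := ⟨x, hxB, hxp⟩
    rwa [hB.2.2] at this
  have hqp : p ≤ q := by
    have := ptype_mono X (hBU.trans inter_subset_right) hB.mem_ptype
    rwa [hA.2.2] at this
  obtain rfl := le_antisymm hpq hqp
  exact ⟨B, hB, hxB, hBU.trans inter_subset_left⟩

theorem isUpperSet_ptype (hX : IsTrimPartition X) {U : Set W} (hU : IsOpen U) :
    IsUpperSet (ptype X U) := by
  rintro p q hpq ⟨x, hxU, hxp⟩
  obtain ⟨A, hA, -, hAU⟩ := hX.exists_trim_subset hU hxU hxp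
  refine ptype_mono X hAU ?_
  rw [hA.2.2]
  exact hpq

theorem ptype_nonempty (hX : IsTrimPartition X) {U : Set W} (hU : IsOpen U) (hne : U.Nonempty) :
    (ptype X U).Nonempty := by
  obtain ⟨x, hx⟩ := hne
  obtain ⟨p, A, hA, -, hAU⟩ := hX.2.1 x U (hU.mem_nhds hx)
  exact ⟨p, ptype_mono X hAU hA.mem_ptype⟩

theorem ptype_eq_empty_iff (hX : IsTrimPartition X) {U : Set W} (hU : IsOpen U) :
    ptype X U = ∅ ↔ U = ∅ := by
  constructor
  · intro h
    by_contra hne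
    exact (hX.ptype_nonempty hU (nonempty_iff_ne_empty.2 hne)).ne_empty h
  · rintro rfl
    simp [ptype]

theorem isTrimSet_of_subset (hX : IsTrimPartition X) {p : P} {A : Set W} (hc : IsCompact A)
    (ho : IsOpen A) (hp : p ∈ ptype X A) (hA : ptype X A ⊆ Ici p) : IsTrimSet X p A :=
  ⟨hc, ho, hA.antisymm fun _ hq => hX.isUpperSet_ptype ho hq hp⟩

theorem infinite_of_lt [T1Space W] (hX : IsTrimPartition X) {U : Set W} (hU : IsOpen U) {p q : P}
    (hp : p ∈ ptype X U) (hpq : p < q) : (U ∩ X q).Infinite := by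
  intro hfin
  obtain ⟨x, hxU, hxp⟩ := hp
  have hx : x ∉ U ∩ X q := fun h =>
    Set.disjoint_left.1 (hX.1.pairwise_disjoint hpq.ne) hxp h.2
  have hq : q ∈ ptype X (U \ (U ∩ X q)) :=
    hX.isUpperSet_ptype (hU.sdiff hfin.isClosed) hpq.le ⟨x, ⟨hxU, hx⟩, hxp⟩
  obtain ⟨y, hy, hyq⟩ := hq
  exact hy.2 ⟨hy.1, hyq⟩

theorem finite_of_isTrimSet [T2Space W] (hX : IsTrimPartition X) (hI : IsIsolatedFamily I X)
    {p : P} (hp : p ∈ I) {A : Set W} (hA : IsTrimSet X p A) : (A ∩ X p).Finite := by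
  have hcl : IsClosed (A ∩ X p) := by
    rw [← closure_subset_iff_isClosed]
    intro x hx
    have hxA : x ∈ A := hA.1.isClosed.closure_subset_iff.2 inter_subset_left hx
    refine ⟨hxA, hX.2.2.2 p x fun U hU => ?_⟩
    obtain ⟨q, B, hB, hxB, hBU⟩ := hX.2.1 x (U ∩ A) (Filter.inter_mem hU (hA.2.1.mem_nhds hxA))
    obtain ⟨y, hyB, -, hyp⟩ := mem_closure_iff.1 hx B hB.2.1 hxB
    have hpq : q ≤ p := by
      have : p ∈ ptype X B := ⟨y, hyB, hyp⟩
      rwa [hB.2.2] at this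
    have hqp : p ≤ q := by
      have := ptype_mono X (hBU.trans inter_subset_right) hB.mem_ptype
      rwa [hA.2.2] at this
    obtain rfl := le_antisymm hpq hqp
    exact ⟨B, hB, hxB, hBU.trans inter_subset_left⟩
  refine (hA.1.of_isClosed_subset hcl inter_subset_left).finite ?_
  rw [isDiscrete_iff_forall_mem_exists_isOpen]
  rintro x ⟨hxA, hxp⟩
  obtain ⟨U, hU, hUx⟩ := hI.2.1 p hp x hxp
  refine ⟨U ∩ A, hU.inter hA.2.1, ?_⟩
  ext y
  constructor
  · rintro ⟨⟨h1, -⟩, -, h2⟩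
    rw [← hUx]; exact ⟨h1, h2⟩
  · intro h
    have : y ∈ U ∩ X p := by rw [hUx]; exact h
    rw [mem_singleton_iff.1 h] at this ⊢
    exact ⟨⟨this.1, hxA⟩, hxA, hxp⟩

end IsTrimPartition

theorem IsIsolatedFamily.infinite_of_notMem [T1Space W] (hI : IsIsolatedFamily I X) {p : P}
    (hp : p ∉ I) {U : Set W} (hU : IsOpen U) (hpU : p ∈ ptype X U) : (U ∩ X p).Infinite := by
  intro hfin
  obtain ⟨x, hxU, hxp⟩ := hpU
  refine hI.1 p hp x hxp ⟨U \ ((U ∩ X p) \ {x}), hU.sdiff (hfin.subset sdiff_subset).isClosed, ?_⟩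
  ext y
  constructor
  · rintro ⟨⟨h1, h2⟩, h3⟩
    by_contra h
    exact h2 ⟨⟨h1, h3⟩, h⟩
  · rintro rfl
    exact ⟨⟨hxU, fun h => h.2 rfl⟩, hxp⟩

end TrimPartition

/-- Two sets, in possibly different partitioned spaces, meet corresponding parts in equally
many points, where all infinite sets count as equinumerous. -/
def CountEq {W' : Type*} (X : P → Set W) (X' : P → Set W') (A : Set W) (A' : Set W') : Prop :=
  ∀ p, (A ∩ X p).encard = (A' ∩ X' p).encard

section CountEq

variable {W' : Type*} [TopologicalSpace W'] {X : P → Set W} {X' : P → Set W'} {I : Set P}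

theorem CountEq.symm {A : Set W} {A' : Set W'} (h : CountEq X X' A A') : CountEq X' X A' A :=
  fun p => (h p).symm

theorem CountEq.ptype_eq {A : Set W} {A' : Set W'} (h : CountEq X X' A A') :
    ptype X A = ptype X' A' := by
  ext p
  rw [mem_ptype_iff_encard_ne_zero, mem_ptype_iff_encard_ne_zero, h p]

theorem encard_union_inter (X : P → Set W) {A B : Set W} (h : Disjoint A B) (p : P) :
    ((A ∪ B) ∩ X p).encard = (A ∩ X p).encard + (B ∩ X p).encard := by
  rw [union_inter_distrib_right,
    encard_union_eq (h.mono inter_subset_left inter_subset_left)]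

theorem CountEq.union {A B : Set W} {A' B' : Set W'} (hA : CountEq X X' A A')
    (hB : CountEq X X' B B') (h : Disjoint A B) (h' : Disjoint A' B') :
    CountEq X X' (A ∪ B) (A' ∪ B') := fun p => by
  rw [encard_union_inter X h, encard_union_inter X' h', hA p, hB p]

theorem CountEq.empty : CountEq X X' ∅ ∅ := fun p => by simp

theorem CountEq.eq_empty_iff (hX : IsTrimPartition X) (hX' : IsTrimPartition X') {A : Set W}
    {A' : Set W'} (hA : IsOpen A) (hA' : IsOpen A') (h : CountEq X X' A A') :
    A = ∅ ↔ A' = ∅ := by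
  rw [← hX.ptype_eq_empty_iff hA, h.ptype_eq, hX'.ptype_eq_empty_iff hA']

theorem CountEq.isTrimSet {A : Set W} {A' : Set W'} (h : CountEq X X' A A') {p : P}
    (hA : IsTrimSet X p A) (hc : IsCompact A') (ho : IsOpen A') : IsTrimSet X' p A' :=
  ⟨hc, ho, h.ptype_eq ▸ hA.2.2⟩

theorem countEq_of_isTrimSet [T1Space W] [T1Space W'] (hX : IsTrimPartition X)
    (hX' : IsTrimPartition X') {p : P} {A : Set W} {A' : Set W'} (hA : IsTrimSet X p A)
    (hA' : IsTrimSet X' p A') (h : (A ∩ X p).encard = (A' ∩ X' p).encard) :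
    CountEq X X' A A' := by
  intro q
  by_cases hpq : p ≤ q
  · rcases hpq.eq_or_lt with rfl | hlt
    · exact h
    · rw [(hX.infinite_of_lt hA.2.1 hA.mem_ptype hlt).encard_eq,
        (hX'.infinite_of_lt hA'.2.1 hA'.mem_ptype hlt).encard_eq]
  · have h1 : q ∉ ptype X A := by rwa [hA.2.2]
    have h2 : q ∉ ptype X' A' := by rwa [hA'.2.2]
    rw [mem_ptype_iff_encard_ne_zero, not_not] at h1 h2
    rw [h1, h2]

theorem exists_isTrimSet_countEq [T2Space W] [T2Space W'] (hX : IsTrimPartition X)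
    (hX' : IsTrimPartition X') (hI : IsIsolatedFamily I X) (hI' : IsIsolatedFamily I X') {p : P}
    {B : Set W} (hB : IsTrimSet X p B) {U : Set W'} (hU : IsOpen U)
    (h : (B ∩ X p).encard ≤ (U ∩ X' p).encard) :
    ∃ D, IsTrimSet X' p D ∧ D ⊆ U ∧ CountEq X X' B D := by
  have hne : (B ∩ X p).encard ≠ 0 := mem_ptype_iff_encard_ne_zero.1 hB.mem_ptype
  by_cases hp : p ∈ I
  · obtain ⟨S, hSU, hSc⟩ := exists_subset_encard_eq h
    have hSfin : S.Finite := by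
      rw [← encard_ne_top_iff, hSc, encard_ne_top_iff]
      exact hX.finite_of_isTrimSet hI hp hB
    have hSne : S.Nonempty := by rwa [← encard_ne_zero, hSc]
    have hex : ∀ x ∈ S, ∃ D, IsTrimSet X' p D ∧ D ⊆ U ∧ D ∩ X' p = {x} := by
      intro x hx
      obtain ⟨V, hV, hVx⟩ := hI'.2.1 p hp x (hSU hx).2
      have hxV : x ∈ V ∩ X' p := by rw [hVx]; rfl
      obtain ⟨D, hD, hxD, hDV⟩ :=
        hX'.exists_trim_subset (hU.inter hV) ⟨(hSU hx).1, hxV.1⟩ hxV.2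
      refine ⟨D, hD, hDV.trans inter_subset_left, ?_⟩
      apply Subset.antisymm
      · rw [← hVx]
        exact inter_subset_inter_left _ (hDV.trans inter_subset_right)
      · rintro y rfl
        exact ⟨hxD, hxV.2⟩
    choose! D hD hDU hDx using hex
    have hS : (⋃ x ∈ S, D x) ∩ X' p = S := by
      rw [iUnion₂_inter, iUnion₂_congr hDx, biUnion_of_singleton]
    have htrim : IsTrimSet X' p (⋃ x ∈ S, D x) := by
      refine hX'.isTrimSet_of_subset (hSfin.isCompact_biUnion fun x hx => (hD x hx).1)
        (isOpen_biUnion fun x hx => (hD x hx).2.1) ?_ ?_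
      · rwa [mem_ptype_iff_encard_ne_zero, hS, encard_ne_zero]
      · rintro q ⟨y, hy, hyq⟩
        obtain ⟨x, hx, hyx⟩ := mem_iUnion₂.1 hy
        rw [← (hD x hx).2.2]
        exact ⟨y, hyx, hyq⟩
    refine ⟨_, htrim, iUnion₂_subset hDU, countEq_of_isTrimSet hX hX' hB htrim ?_⟩
    rw [hS, hSc]
  · have : (U ∩ X' p).Nonempty := by
      rw [← encard_ne_zero]
      exact fun h0 => hne (le_zero_iff.1 (h0 ▸ h))
    obtain ⟨x, hxU, hxp⟩ := this
    obtain ⟨D, hD, -, hDU⟩ := hX'.exists_trim_subset hU hxU hxp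
    refine ⟨D, hD, hDU, countEq_of_isTrimSet hX hX' hB hD ?_⟩
    rw [(hI.infinite_of_notMem hp hB.2.1 hB.mem_ptype).encard_eq,
      (hI'.infinite_of_notMem hp hD.2.1 hD.mem_ptype).encard_eq]

end CountEq

section Decomposition

variable {X : P → Set W}

theorem ptype_union (X : P → Set W) (A B : Set W) :
    ptype X (A ∪ B) = ptype X A ∪ ptype X B := by
  ext p
  simp only [ptype, mem_ofPred_eq, mem_union, union_inter_distrib_right, union_nonempty]

theorem ptype_finset_sup {ι : Type*} (X : P → Set W) (s : Finset ι) (D : ι → CompactOpens W) :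
    ptype X (s.sup D : CompactOpens W) = ⋃ i ∈ s, ptype X (D i) := by
  ext p
  simp only [ptype, mem_ofPred_eq, CompactOpens.coe_finsetSup, mem_iUnion, iUnion_inter,
    nonempty_iUnion]

/-- A finite disjoint union of trim sets whose labels form an antichain. -/
def IsTrimSum (X : P → Set W) (F : Finset P) (D : P → CompactOpens W) : Prop :=
  (∀ f ∈ F, IsTrimSet X f (D f)) ∧ (∀ f ∈ F, ∀ g ∈ F, f ≤ g → f = g) ∧
    (F : Set P).PairwiseDisjoint D

theorem IsTrimSum.mem_ptype_iff {F : Finset P} {D : P → CompactOpens W} (h : IsTrimSum X F D)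
    {p : P} : p ∈ ptype X (F.sup D : CompactOpens W) ↔ ∃ f ∈ F, f ≤ p := by
  rw [ptype_finset_sup, mem_iUnion₂]
  refine ⟨fun ⟨f, hf, hp⟩ => ⟨f, hf, ?_⟩, fun ⟨f, hf, hp⟩ => ⟨f, hf, ?_⟩⟩
  · rwa [(h.1 f hf).2.2] at hp
  · rwa [(h.1 f hf).2.2]

theorem IsTrimSum.inter_eq {F : Finset P} {D : P → CompactOpens W} (h : IsTrimSum X F D)
    {f : P} (hf : f ∈ F) : ((F.sup D : CompactOpens W) : Set W) ∩ X f = (D f : Set W) ∩ X f := by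
  apply Subset.antisymm
  · rintro x ⟨hx, hxf⟩
    rw [CompactOpens.coe_finsetSup] at hx
    obtain ⟨g, hg, hxg⟩ := mem_iUnion₂.1 hx
    have hgf : g ≤ f := by
      have : f ∈ ptype X (D g) := ⟨x, hxg, hxf⟩
      rwa [(h.1 g hg).2.2] at this
    obtain rfl := h.2.1 g hg f hf hgf
    exact ⟨hxg, hxf⟩
  · exact inter_subset_inter_left _ (Finset.le_sup (f := D) hf)

theorem IsTrimSum.exists_sup_eq_sup_isTrimSet [T2Space W] (hX : IsTrimPartition X) {F : Finset P}
    {D : P → CompactOpens W} (h : IsTrimSum X F D) {p : P} {B : CompactOpens W}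
    (hB : IsTrimSet X p B) :
    ∃ (F' : Finset P) (D' : P → CompactOpens W), IsTrimSum X F' D' ∧
      F'.sup D' = F.sup D ⊔ B := by
  classical
  set A := F.sup D with hA
  have hdisj : ∀ f ∈ F, Disjoint (D f) (B \ A) := fun f hf =>
    disjoint_sdiff_self_right.mono_left (Finset.le_sup (f := D) hf)
  have htB : ptype X (B \ A : CompactOpens W) ⊆ Ici p := by
    rw [← hB.2.2]
    exact ptype_mono X (by simp)
  by_cases hex : ∃ f ∈ F, f ≤ p
  · obtain ⟨f, hf, hfp⟩ := hex
    refine ⟨F, Function.update D f (D f ⊔ (B \ A)), ⟨?_, h.2.1, ?_⟩, ?_⟩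
    · intro g hg
      rcases eq_or_ne g f with rfl | hgf
      · rw [Function.update_self]
        refine hX.isTrimSet_of_subset (CompactOpens.isCompact _) (CompactOpens.isOpen _) ?_ ?_
        · exact ptype_mono X (by simp) (h.1 g hg).mem_ptype
        · rw [CompactOpens.coe_sup, ptype_union, (h.1 g hg).2.2]
          exact union_subset le_rfl (htB.trans (Ici_subset_Ici.2 hfp))
      · rw [Function.update_of_ne hgf]
        exact h.1 g hg
    · intro g hg k hk hgk
      have hgk' := h.2.2 hg hk hgk
      simp only [Function.onFun] at hgk' ⊢
      rcases eq_or_ne g f with rfl | hgf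
      · rw [Function.update_self, Function.update_of_ne hgk.symm]
        exact disjoint_sup_left.2 ⟨hgk', (hdisj k hk).symm⟩
      · rw [Function.update_of_ne hgf]
        rcases eq_or_ne k f with rfl | hkf
        · rw [Function.update_self]
          exact disjoint_sup_right.2 ⟨hgk', hdisj g hg⟩
        · rwa [Function.update_of_ne hkf]
    · have hD : D = Function.update D f (D f) := (Function.update_eq_self f D).symm
      have h1 : F = insert f (F.erase f) := (Finset.insert_erase hf).symm
      have h2 : (F.erase f).sup (Function.update D f (D f ⊔ (B \ A))) = (F.erase f).sup D :=
        Finset.sup_congr rfl fun g hg => Function.update_of_ne (Finset.ne_of_mem_erase hg) _ _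
      have h3 : A = D f ⊔ (F.erase f).sup D := by
        rw [hA, ← Finset.sup_insert, Finset.insert_erase hf]
      rw [← Finset.insert_erase hf, Finset.sup_insert, h2, Function.update_self, sup_right_comm,
        ← h3, sup_sdiff_self]
  · push Not at hex
    have hpA : p ∉ ptype X A := by
      rw [hA, h.mem_ptype_iff]
      rintro ⟨f, hf, hfp⟩
      exact hex f hf hfp
    set G := F.filter fun f => p ≤ f with hG
    set H := F.filter fun f => ¬ p ≤ f with hH
    have hpH : p ∉ H := by simp [hH]
    have hpF : p ∉ F := fun hp => hex p hp le_rfl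
    have hsup : F.sup D = H.sup D ⊔ G.sup D := by
      rw [← Finset.sup_union, Finset.union_comm, Finset.filter_union_filter_not_eq]
    have hHD : ∀ g ∈ H, Function.update D p (B \ A ⊔ G.sup D) g = D g := fun g hg =>
      Function.update_of_ne (ne_of_mem_of_not_mem hg hpH) _ _
    have hHdisj : ∀ g ∈ H, Disjoint (D g) (B \ A ⊔ G.sup D) := fun g hg => by
      have hgF := Finset.mem_filter.1 hg
      refine disjoint_sup_right.2 ⟨hdisj g hgF.1, ?_⟩
      rw [Finset.disjoint_sup_right]
      intro k hk
      have hkF := Finset.mem_filter.1 hk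
      exact h.2.2 hgF.1 hkF.1 fun he => hgF.2 (he ▸ hkF.2)
    refine ⟨insert p H, Function.update D p (B \ A ⊔ G.sup D), ⟨?_, ?_, ?_⟩, ?_⟩
    · intro g hg
      rcases Finset.mem_insert.1 hg with rfl | hgH
      · rw [Function.update_self]
        refine hX.isTrimSet_of_subset (CompactOpens.isCompact _) (CompactOpens.isOpen _) ?_ ?_
        · have h1 : g ∈ ptype X ((A : Set W) ∪ (B \ A : CompactOpens W)) := by
            refine ptype_mono X ?_ hB.mem_ptype
            simp
          rw [ptype_union] at h1
          rw [CompactOpens.coe_sup, ptype_union]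
          exact Or.inl (h1.resolve_left hpA)
        · rw [CompactOpens.coe_sup, ptype_union, ptype_finset_sup]
          refine union_subset htB (iUnion₂_subset fun f hf => ?_)
          have hfF := Finset.mem_filter.1 hf
          rw [(h.1 f hfF.1).2.2]
          exact Ici_subset_Ici.2 hfF.2
      · rw [hHD g hgH]
        exact h.1 g (Finset.mem_filter.1 hgH).1
    · intro f hf g hg hfg
      rcases Finset.mem_insert.1 hf with rfl | hfH <;> rcases Finset.mem_insert.1 hg with rfl | hgH
      · rfl
      · exact absurd hfg (Finset.mem_filter.1 hgH).2
      · exact absurd hfg (hex f (Finset.mem_filter.1 hfH).1)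
      · exact h.2.1 f (Finset.mem_filter.1 hfH).1 g (Finset.mem_filter.1 hgH).1 hfg
    · rw [Finset.coe_insert, Set.pairwiseDisjoint_insert]
      refine ⟨?_, ?_⟩
      · intro f hf g hg hfg
        simp only [Function.onFun]
        rw [hHD f hf, hHD g hg]
        exact h.2.2 (Finset.mem_filter.1 hf).1 (Finset.mem_filter.1 hg).1 hfg
      · intro g hg _
        rw [Function.update_self, hHD g hg]
        exact (hHdisj g hg).symm
    · rw [Finset.sup_insert, Function.update_self, Finset.sup_congr rfl hHD, sup_assoc,
        sup_comm (G.sup D), ← hsup, ← hA, sdiff_sup_self, sup_comm]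

theorem exists_isTrimSum [T2Space W] (hX : IsTrimPartition X) (A : CompactOpens W) :
    ∃ (F : Finset P) (D : P → CompactOpens W), IsTrimSum X F D ∧ F.sup D = A := by
  classical
  have hcov : ∀ x ∈ (A : Set W), ∃ B : CompactOpens W, x ∈ (B : Set W) ∧ B ≤ A ∧
      ∃ p, IsTrimSet X p B := by
    intro x hx
    obtain ⟨p, B, hB, hxB, hBA⟩ := hX.2.1 x A (A.isOpen.mem_nhds hx)
    exact ⟨⟨⟨B, hB.1⟩, hB.2.1⟩, hxB, hBA, p, hB⟩
  choose! B hxB hBA p hB using hcov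
  obtain ⟨t, htA, ht⟩ := A.isCompact.elim_nhds_subcover (fun x => (B x : Set W))
    fun x hx => (B x).isOpen.mem_nhds (hxB x hx)
  have hA : t.sup B = A := by
    apply le_antisymm
    · exact Finset.sup_le fun x hx => hBA x (htA x hx)
    · change (A : Set W) ⊆ (t.sup B : CompactOpens W)
      rwa [CompactOpens.coe_finsetSup]
  rw [← hA]
  clear hA ht
  induction t using Finset.induction_on with
  | empty => exact ⟨∅, fun _ => ⊥, by simp [IsTrimSum], by simp⟩
  | insert x t hxt ih =>
    obtain ⟨F, D, hD, hF⟩ := ih fun y hy => htA y (Finset.mem_insert_of_mem hy)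
    obtain ⟨F', D', hD', hF'⟩ :=
      hD.exists_sup_eq_sup_isTrimSet hX (hB x (htA x (Finset.mem_insert_self x t)))
    exact ⟨F', D', hD', by rw [hF', hF, Finset.sup_insert, sup_comm]⟩

end Decomposition

theorem TopologicalSpace.CompactOpens.disjoint_coe [T2Space W] {A B : CompactOpens W}
    (h : Disjoint A B) : Disjoint (A : Set W) B := by
  rw [disjoint_iff_inter_eq_empty, ← CompactOpens.coe_inf, h.eq_bot, CompactOpens.coe_bot]

theorem Finset.sup_sdiff_sup_eq {α ι : Type*} [GeneralizedBooleanAlgebra α] {s : Finset ι}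
    {D E : ι → α} (hD : (s : Set ι).PairwiseDisjoint D) (hE : ∀ i ∈ s, E i ≤ D i) :
    s.sup D \ s.sup E = s.sup fun i => D i \ E i := by
  have hsup : s.sup E ⊔ s.sup (fun i => D i \ E i) = s.sup D := by
    rw [← Finset.sup_sup]
    exact Finset.sup_congr rfl fun i hi => sup_sdiff_cancel_right (hE i hi)
  have hdisj : Disjoint (s.sup E) (s.sup fun i => D i \ E i) := by
    rw [Finset.disjoint_sup_left]
    intro i hi
    rw [Finset.disjoint_sup_right]
    intro j hj
    rcases eq_or_ne i j with rfl | hij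
    · exact disjoint_sdiff_self_right
    · exact (hD hi hj hij).mono (hE i hi) sdiff_le
  rw [← hsup, hdisj.sup_sdiff_cancel_left]

section Splitting

variable {W' : Type*} [TopologicalSpace W'] {X : P → Set W} {X' : P → Set W'} {I : Set P}

theorem CountEq.finset_sup {ι : Type*} {s : Finset ι} {D : ι → CompactOpens W}
    {D' : ι → CompactOpens W'} (h : ∀ i ∈ s, CountEq X X' (D i) (D' i))
    (hD : (s : Set ι).PairwiseDisjoint D) (hD' : (s : Set ι).PairwiseDisjoint D')
    [T2Space W] [T2Space W'] :
    CountEq X X' (s.sup D : CompactOpens W) (s.sup D' : CompactOpens W') := by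
  classical
  induction s using Finset.induction_on with
  | empty => exact CountEq.empty
  | insert i s hi ih =>
    rw [Finset.coe_insert, pairwiseDisjoint_insert_of_notMem (by simpa using hi)] at hD hD'
    rw [Finset.sup_insert, Finset.sup_insert, CompactOpens.coe_sup, CompactOpens.coe_sup]
    refine (h i (Finset.mem_insert_self i s)).union
      (ih (fun j hj => h j (Finset.mem_insert_of_mem hj)) hD.1 hD'.1) ?_ ?_
    · have : Disjoint (D i) (s.sup D) := Finset.disjoint_sup_right.2 fun j hj => hD.2 j hj
      exact CompactOpens.disjoint_coe this
    · have : Disjoint (D' i) (s.sup D') := Finset.disjoint_sup_right.2 fun j hj => hD'.2 j hj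
      exact CompactOpens.disjoint_coe this

variable [T2Space W] [T2Space W']

theorem encard_inter_eq_add_sdiff (X : P → Set W) {A B : Set W} (h : B ⊆ A) (p : P) :
    (A ∩ X p).encard = (B ∩ X p).encard + (A \ B ∩ X p).encard := by
  rw [← encard_union_inter X disjoint_sdiff_self_right, union_sdiff_cancel h]

theorem exists_countEq_of_forall_infinite (hX : IsTrimPartition X) (hX' : IsTrimPartition X')
    (hI : IsIsolatedFamily I X) (hI' : IsIsolatedFamily I X') (B : CompactOpens W) {U : Set W'}
    (hU : IsOpen U)
    (H : ∀ E : CompactOpens W', ptype X' E ⊆ ptype X B → ∀ g ∈ ptype X B,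
      (U \ E ∩ X' g).Infinite) :
    ∃ B' : CompactOpens W', (B' : Set W') ⊆ U ∧ CountEq X X' B B' := by
  classical
  obtain ⟨F, D, hD, rfl⟩ := exists_isTrimSum hX B
  suffices h : ∀ G ⊆ F, ∃ B' : CompactOpens W', (B' : Set W') ⊆ U ∧
      CountEq X X' (G.sup D : CompactOpens W) B' from h F subset_rfl
  intro G
  induction G using Finset.induction_on with
  | empty => exact fun _ => ⟨⊥, by simp, CountEq.empty⟩
  | insert g G hg ih =>
    intro hGF
    obtain ⟨B', hB'U, hB'⟩ := ih ((Finset.subset_insert g G).trans hGF)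
    have hgF : g ∈ F := hGF (Finset.mem_insert_self g G)
    have hinf : (U \ B' ∩ X' g).Infinite := by
      refine H B' ?_ g (hD.mem_ptype_iff.2 ⟨g, hgF, le_rfl⟩)
      rw [← hB'.ptype_eq]
      exact ptype_mono X (Finset.sup_mono (f := D) ((Finset.subset_insert g G).trans hGF))
    obtain ⟨E, hE, hEU, hgE⟩ := exists_isTrimSet_countEq hX hX' hI hI' (hD.1 g hgF)
      (hU.sdiff B'.isCompact.isClosed) (hinf.encard_eq ▸ le_top)
    refine ⟨⟨⟨E, hE.1⟩, hE.2.1⟩ ⊔ B', ?_, ?_⟩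
    · exact union_subset (hEU.trans sdiff_subset) hB'U
    · rw [Finset.sup_insert, CompactOpens.coe_sup, CompactOpens.coe_sup]
      refine hgE.union hB' ?_ (disjoint_sdiff_self_left.mono_left hEU)
      have : Disjoint (D g) (G.sup D) := Finset.disjoint_sup_right.2 fun j hj =>
        hD.2.2 hgF (hGF (Finset.mem_insert_of_mem hj)) fun he => hg (he ▸ hj)
      exact CompactOpens.disjoint_coe this

theorem exists_split_of_notMem_ptype (hX : IsTrimPartition X) (hX' : IsTrimPartition X')
    (hI : IsIsolatedFamily I X) (hI' : IsIsolatedFamily I X') {p : P} {A B : CompactOpens W}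
    {A' : CompactOpens W'} (hA : IsTrimSet X p A) (h : CountEq X X' A A') (hBA : B ≤ A)
    (hpB : p ∉ ptype X B) :
    ∃ B' ≤ A', CountEq X X' B B' ∧
      CountEq X X' (A \ B : CompactOpens W) (A' \ B' : CompactOpens W') := by
  have hA' := h.isTrimSet hA A'.isCompact A'.isOpen
  have hsub : ptype X B ⊆ Ici p := (ptype_mono X hBA).trans hA.2.2.le
  have hmem : ∀ E : CompactOpens W', p ∉ ptype X' E → p ∈ ptype X' ((A' : Set W') \ E) := by
    rintro E hE
    obtain ⟨x, hxA, hxp⟩ := hA'.mem_ptype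
    exact ⟨x, ⟨hxA, fun hxE => hE ⟨x, hxE, hxp⟩⟩, hxp⟩
  obtain ⟨B', hB'A, hB'⟩ := exists_countEq_of_forall_infinite hX hX' hI hI' B A'.isOpen (by
    intro E hE g hg
    refine hX'.infinite_of_lt (A'.isOpen.sdiff E.isCompact.isClosed)
      (hmem E fun hp => hpB (hE hp)) ((hsub hg).lt_of_ne ?_)
    rintro rfl
    exact hpB hg)
  refine ⟨B', hB'A, hB', ?_⟩
  have hpB' : p ∉ ptype X' B' := by rwa [← hB'.ptype_eq]
  have e1 := encard_inter_eq_add_sdiff X hBA p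
  have e2 := encard_inter_eq_add_sdiff X' hB'A p
  have z1 := hpB
  have z2 := hpB'
  rw [mem_ptype_iff_encard_ne_zero, not_not] at z1 z2
  rw [z1, zero_add] at e1
  rw [z2, zero_add] at e2
  refine countEq_of_isTrimSet (p := p) hX hX' ?_ ?_ ?_
  · refine hX.isTrimSet_of_subset (CompactOpens.isCompact _) (CompactOpens.isOpen _) ?_ ?_
    · rw [mem_ptype_iff_encard_ne_zero, CompactOpens.coe_sdiff, ← e1,
        ← mem_ptype_iff_encard_ne_zero]
      exact hA.mem_ptype
    · exact (ptype_mono X sdiff_subset).trans hA.2.2.le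
  · refine hX'.isTrimSet_of_subset (CompactOpens.isCompact _) (CompactOpens.isOpen _) ?_ ?_
    · exact hmem B' hpB'
    · exact (ptype_mono X' sdiff_subset).trans hA'.2.2.le
  · rw [CompactOpens.coe_sdiff, CompactOpens.coe_sdiff, ← e1, ← e2, h p]

theorem exists_split_of_isTrimSet (hX : IsTrimPartition X) (hX' : IsTrimPartition X')
    (hI : IsIsolatedFamily I X) (hI' : IsIsolatedFamily I X') {p : P} {A B : CompactOpens W}
    {A' : CompactOpens W'} (hA : IsTrimSet X p A) (h : CountEq X X' A A') (hBA : B ≤ A) :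
    ∃ B' ≤ A', CountEq X X' B B' ∧
      CountEq X X' (A \ B : CompactOpens W) (A' \ B' : CompactOpens W') := by
  have hA' := h.isTrimSet hA A'.isCompact A'.isOpen
  by_cases hpB : p ∈ ptype X B
  swap
  · exact exists_split_of_notMem_ptype hX hX' hI hI' hA h hBA hpB
  by_cases hpC : p ∈ ptype X (A \ B : CompactOpens W)
  swap
  · obtain ⟨C', hC'A, hC', hAC⟩ :=
      exists_split_of_notMem_ptype hX hX' hI hI' hA h sdiff_le hpC
    rw [sdiff_sdiff_eq_self hBA] at hAC
    exact ⟨A' \ C', sdiff_le, hAC, by rwa [sdiff_sdiff_eq_self hC'A]⟩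
  have hB : IsTrimSet X p B := hX.isTrimSet_of_subset B.isCompact B.isOpen hpB
    ((ptype_mono X hBA).trans hA.2.2.le)
  have hC : IsTrimSet X p (A \ B : CompactOpens W) :=
    hX.isTrimSet_of_subset (CompactOpens.isCompact _) (CompactOpens.isOpen _) hpC
      ((ptype_mono X sdiff_subset).trans hA.2.2.le)
  have e1 := encard_inter_eq_add_sdiff X hBA p
  have key : ∃ B' : CompactOpens W', B' ≤ A' ∧ IsTrimSet X' p B' ∧ CountEq X X' B B' ∧
      (((A \ B : CompactOpens W) : Set W) ∩ X p).encard =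
        (((A' \ B' : CompactOpens W') : Set W') ∩ X' p).encard := by
    by_cases hp : p ∈ I
    · obtain ⟨E, hE, hEA, hBE⟩ := exists_isTrimSet_countEq hX hX' hI hI' hB A'.isOpen
        (by rw [← h p, e1]; exact le_self_add)
      refine ⟨⟨⟨E, hE.1⟩, hE.2.1⟩, hEA, hE, hBE, ?_⟩
      have e2 := encard_inter_eq_add_sdiff X' hEA p
      rw [← h p, e1, hBE p] at e2
      refine (ENat.addLECancellable_of_ne_top ?_).inj.1 e2
      rw [encard_ne_top_iff]
      exact hX'.finite_of_isTrimSet hI' hp hE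
    · obtain ⟨x, hxA, hxp⟩ := hA'.mem_ptype
      have hinf : ((A' : Set W') \ {x} ∩ X' p).Infinite := by
        have := (hI'.infinite_of_notMem hp A'.isOpen hA'.mem_ptype).sdiff (finite_singleton x)
        exact this.mono fun y hy => ⟨⟨hy.1.1, hy.2⟩, hy.1.2⟩
      obtain ⟨E, hE, hEA, hBE⟩ := exists_isTrimSet_countEq hX hX' hI hI' hB
        (A'.isOpen.sdiff isClosed_singleton) (hinf.encard_eq ▸ le_top)
      refine ⟨⟨⟨E, hE.1⟩, hE.2.1⟩, hEA.trans sdiff_subset, hE, hBE, ?_⟩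
      rw [(hI.infinite_of_notMem hp (CompactOpens.isOpen _) hpC).encard_eq,
        (hI'.infinite_of_notMem hp (CompactOpens.isOpen _) ?_).encard_eq]
      exact ⟨x, ⟨hxA, fun hxE => (hEA hxE).2 rfl⟩, hxp⟩
  obtain ⟨B', hB'A, hB', hBB', heq⟩ := key
  refine ⟨B', hB'A, hBB', countEq_of_isTrimSet hX hX' hC ?_ heq⟩
  refine hX'.isTrimSet_of_subset (CompactOpens.isCompact _) (CompactOpens.isOpen _) ?_ ?_
  · rw [mem_ptype_iff_encard_ne_zero, ← heq, ← mem_ptype_iff_encard_ne_zero]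
    exact hpC
  · exact (ptype_mono X' sdiff_subset).trans hA'.2.2.le

theorem CountEq.exists_split (hX : IsTrimPartition X) (hX' : IsTrimPartition X')
    (hI : IsIsolatedFamily I X) (hI' : IsIsolatedFamily I X') {A B : CompactOpens W}
    {A' : CompactOpens W'} (h : CountEq X X' A A') (hBA : B ≤ A) :
    ∃ B' ≤ A', CountEq X X' B B' ∧
      CountEq X X' (A \ B : CompactOpens W) (A' \ B' : CompactOpens W') := by
  obtain ⟨F, D, hD, rfl⟩ := exists_isTrimSum hX A
  obtain ⟨F', D', hD', rfl⟩ := exists_isTrimSum hX' A'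
  have hle : ∀ p, (∃ f ∈ F, f ≤ p) ↔ ∃ f ∈ F', f ≤ p := fun p => by
    rw [← hD.mem_ptype_iff, ← hD'.mem_ptype_iff, h.ptype_eq]
  have hFF : F = F' := by
    ext f
    constructor
    · intro hf
      obtain ⟨g, hg, hgf⟩ := (hle f).1 ⟨f, hf, le_rfl⟩
      obtain ⟨k, hk, hkg⟩ := (hle g).2 ⟨g, hg, le_rfl⟩
      obtain rfl := hD.2.1 k hk f hf (hkg.trans hgf)
      rwa [le_antisymm hkg hgf]
    · intro hf
      obtain ⟨g, hg, hgf⟩ := (hle f).2 ⟨f, hf, le_rfl⟩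
      obtain ⟨k, hk, hkg⟩ := (hle g).1 ⟨g, hg, le_rfl⟩
      obtain rfl := hD'.2.1 k hk f hf (hkg.trans hgf)
      rwa [le_antisymm hkg hgf]
  subst hFF
  have hDD' : ∀ f ∈ F, CountEq X X' (D f) (D' f) := fun f hf => by
    refine countEq_of_isTrimSet hX hX' (hD.1 f hf) (hD'.1 f hf) ?_
    rw [← hD.inter_eq hf, ← hD'.inter_eq hf, h f]
  have hsplit : ∀ f ∈ F, ∃ E ≤ D' f, CountEq X X' (B ⊓ D f : CompactOpens W) E ∧
      CountEq X X' (D f \ (B ⊓ D f) : CompactOpens W) (D' f \ E : CompactOpens W') :=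
    fun f hf => exists_split_of_isTrimSet hX hX' hI hI' (hD.1 f hf) (hDD' f hf) inf_le_right
  choose! E hED hBE hCE using hsplit
  have hB : F.sup (fun f => B ⊓ D f) = B := by
    rw [← Finset.sup_inf_distrib_left, inf_eq_left.2 hBA]
  refine ⟨F.sup E, Finset.sup_mono_fun hED, ?_, ?_⟩
  · have := CountEq.finset_sup hBE (hD.2.2.mono_on fun f _ => inf_le_right)
      (hD'.2.2.mono_on hED)
    rwa [hB] at this
  · have := CountEq.finset_sup hCE (hD.2.2.mono_on fun f _ => sdiff_le)
      (hD'.2.2.mono_on fun f _ => sdiff_le)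
    rwa [← Finset.sup_sdiff_sup_eq hD.2.2 fun f _ => inf_le_right,
      ← Finset.sup_sdiff_sup_eq hD'.2.2 hED, hB] at this

end Splitting

section BackAndForth

variable {γ : Type*} [GeneralizedBooleanAlgebra γ]

/-- The suprema of the subsets of a finite set. -/
def subSups (s : Finset γ) : Set γ := {z | ∃ t ⊆ s, t.sup id = z}

theorem mem_subSups_of_mem {s : Finset γ} {z : γ} (hz : z ∈ s) : z ∈ subSups s :=
  ⟨{z}, by simpa using hz, by simp⟩

theorem sup_mem_subSups {s : Finset γ} {z w : γ} (hz : z ∈ subSups s) (hw : w ∈ subSups s) :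
    z ⊔ w ∈ subSups s := by
  classical
  obtain ⟨t, ht, rfl⟩ := hz
  obtain ⟨u, hu, rfl⟩ := hw
  exact ⟨t ∪ u, Finset.union_subset ht hu, Finset.sup_union⟩

theorem finset_sup_mem_subSups {ι : Type*} {s : Finset γ} {t : Finset ι} {f : ι → γ}
    (h : ∀ i ∈ t, f i ∈ subSups s) : t.sup f ∈ subSups s := by
  classical
  induction t using Finset.induction_on with
  | empty => exact ⟨∅, by simp, by simp⟩
  | insert i t _ ih =>
    rw [Finset.sup_insert]
    exact sup_mem_subSups (h i (Finset.mem_insert_self i t))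
      (ih fun j hj => h j (Finset.mem_insert_of_mem hj))

theorem subSups_subset {s t : Finset γ} (h : ∀ z ∈ s, z ∈ subSups t) :
    subSups s ⊆ subSups t := by
  rintro _ ⟨u, hu, rfl⟩
  exact finset_sup_mem_subSups fun z hz => h z (hu hz)

theorem sdiff_mem_subSups {s : Finset γ} (hs : (s : Set γ).PairwiseDisjoint id) {z w : γ}
    (hz : z ∈ subSups s) (hw : w ∈ subSups s) : z \ w ∈ subSups s := by
  classical
  obtain ⟨t, ht, rfl⟩ := hz
  obtain ⟨u, hu, rfl⟩ := hw
  refine ⟨t \ u, Finset.sdiff_subset.trans ht, ?_⟩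
  have h1 : t.sup id ⊔ u.sup id = (t \ u).sup id ⊔ u.sup id := by
    rw [← Finset.sup_union, ← Finset.sup_union, Finset.sdiff_union_self_eq_union]
  have h2 : Disjoint ((t \ u).sup id) (u.sup id) := by
    rw [Finset.disjoint_sup_left]
    intro i hi
    rw [Finset.disjoint_sup_right]
    intro j hj
    obtain ⟨hit, hiu⟩ := Finset.mem_sdiff.1 hi
    exact hs (ht hit) (hu hj) fun he => hiu (he ▸ hj)
  rw [← sup_sdiff_right_self (a := t.sup id), h1, h2.sup_sdiff_cancel_right]

theorem subSups_induction {s : Finset γ} (hs : (s : Set γ).PairwiseDisjoint id) {S : γ → Prop}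
    (hbot : S ⊥) (hsup : ∀ z w, S z → S w → Disjoint z w → S (z ⊔ w)) (hS : ∀ z ∈ s, S z)
    {z : γ} (hz : z ∈ subSups s) : S z := by
  classical
  obtain ⟨t, ht, rfl⟩ := hz
  induction t using Finset.induction_on with
  | empty => simpa using hbot
  | insert i t hi ih =>
    rw [Finset.sup_insert]
    refine hsup _ _ (hS i (ht (Finset.mem_insert_self i t)))
      (ih ((Finset.subset_insert i t).trans ht)) ?_
    rw [Finset.disjoint_sup_right]
    exact fun j hj => hs (ht (Finset.mem_insert_self i t)) (ht (Finset.mem_insert_of_mem hj))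
      fun he => hi (he ▸ hj)

theorem exists_refinement {s : Finset γ} (hs : (s : Set γ).PairwiseDisjoint id) {S : γ → Prop}
    {l : γ → γ} (hl : ∀ z ∈ s, l z ≤ z) (hSl : ∀ z ∈ s, S (l z)) (hSr : ∀ z ∈ s, S (z \ l z))
    {w : γ} (hw : S w) (hsw : Disjoint (s.sup id) w) :
    ∃ t : Finset γ, (t : Set γ).PairwiseDisjoint id ∧ (∀ z ∈ t, S z) ∧
      (∀ z ∈ s, z ∈ subSups t) ∧ s.sup l ⊔ w ∈ subSups t := by
  classical
  set t := insert w (s.image l ∪ s.image fun z => z \ l z) with ht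
  have hlt : ∀ z ∈ s, l z ∈ t := fun z hz =>
    Finset.mem_insert_of_mem (Finset.mem_union_left _ (Finset.mem_image_of_mem _ hz))
  have hrt : ∀ z ∈ s, z \ l z ∈ t := fun z hz =>
    Finset.mem_insert_of_mem (Finset.mem_union_right _ (Finset.mem_image_of_mem _ hz))
  have hcases : ∀ x ∈ s.image l ∪ s.image (fun z => z \ l z),
      ∃ z ∈ s, x = l z ∨ x = z \ l z := by
    intro x hx
    rcases Finset.mem_union.1 hx with hx | hx <;> obtain ⟨z, hz, rfl⟩ := Finset.mem_image.1 hx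
    exacts [⟨z, hz, Or.inl rfl⟩, ⟨z, hz, Or.inr rfl⟩]
  refine ⟨t, ?_, ?_, ?_, ?_⟩
  · rw [ht, Finset.coe_insert, pairwiseDisjoint_insert]
    constructor
    · intro x hx y hy hxy
      obtain ⟨z, hz, hxz⟩ := hcases x hx
      obtain ⟨z', hz', hyz⟩ := hcases y hy
      have hxz' : x ≤ z := by rcases hxz with rfl | rfl; exacts [hl z hz, sdiff_le]
      have hyz' : y ≤ z' := by rcases hyz with rfl | rfl; exacts [hl z' hz', sdiff_le]
      rcases eq_or_ne z z' with rfl | hne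
      · rcases hxz with rfl | rfl <;> rcases hyz with rfl | rfl
        · exact absurd rfl hxy
        · exact disjoint_sdiff_self_right
        · exact disjoint_sdiff_self_left
        · exact absurd rfl hxy
      · exact (hs hz hz' hne).mono hxz' hyz'
    · intro x hx _
      obtain ⟨z, hz, hxz⟩ := hcases x hx
      have hxz' : x ≤ z := by rcases hxz with rfl | rfl; exacts [hl z hz, sdiff_le]
      exact (hsw.mono_left (hxz'.trans (Finset.le_sup (f := id) hz))).symm
  · intro x hx
    rcases Finset.mem_insert.1 hx with rfl | hx
    · exact hw
    · obtain ⟨z, hz, rfl | rfl⟩ := hcases x hx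
      exacts [hSl z hz, hSr z hz]
  · intro z hz
    rw [← sup_sdiff_cancel_right (hl z hz)]
    exact sup_mem_subSups (mem_subSups_of_mem (hlt z hz)) (mem_subSups_of_mem (hrt z hz))
  · exact sup_mem_subSups (finset_sup_mem_subSups fun z hz => mem_subSups_of_mem (hlt z hz))
      (mem_subSups_of_mem (Finset.mem_insert_self _ _))

/-- A finite disjoint family of elements satisfying `S`, one of whose suprema is `z₀`. Such
families are ordered by refinement. -/
structure DisjointFamily (S : γ → Prop) (z₀ : γ) where
  /-- the members of the family -/
  parts : Finset γ
  pairwiseDisjoint : (parts : Set γ).PairwiseDisjoint id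
  forall_mem : ∀ z ∈ parts, S z
  base_mem : z₀ ∈ subSups parts

instance (S : γ → Prop) (z₀ : γ) : Preorder (DisjointFamily S z₀) where
  le s t := ∀ z ∈ s.parts, z ∈ subSups t.parts
  le_refl _ _ hz := mem_subSups_of_mem hz
  le_trans _ _ _ hst htu z hz := subSups_subset htu (hst z hz)

theorem fst_finset_sup {α β ι : Type*} [GeneralizedBooleanAlgebra α] [GeneralizedBooleanAlgebra β]
    (s : Finset ι) (f : ι → α × β) : (s.sup f).1 = s.sup fun i => (f i).1 :=
  Finset.apply_sup_eq_sup_comp Prod.fst (fun _ _ => rfl) rfl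

theorem snd_finset_sup {α β ι : Type*} [GeneralizedBooleanAlgebra α] [GeneralizedBooleanAlgebra β]
    (s : Finset ι) (f : ι → α × β) : (s.sup f).2 = s.sup fun i => (f i).2 :=
  Finset.apply_sup_eq_sup_comp Prod.snd (fun _ _ => rfl) rfl

theorem exists_orderIso_of_backAndForth {α β : Type*} [GeneralizedBooleanAlgebra α]
    [GeneralizedBooleanAlgebra β] [Countable α] [Countable β] (R : α → β → Prop)
    (hbot : R ⊥ ⊥) (hbot_iff : ∀ a b, R a b → (a = ⊥ ↔ b = ⊥))
    (hsup : ∀ a b c d, R a b → R c d → Disjoint a c → Disjoint b d → R (a ⊔ c) (b ⊔ d))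
    (hleft : ∀ a b, R a b → ∀ x ≤ a, ∃ y ≤ b, R x y ∧ R (a \ x) (b \ y))
    (hright : ∀ a b, R a b → ∀ y ≤ b, ∃ x ≤ a, R x y ∧ R (a \ x) (b \ y))
    (a₀ : α) (b₀ : β) (h₀ : R a₀ b₀)
    (hext_left : ∀ a b, a₀ ≤ a → b₀ ≤ b → ∀ x, Disjoint a x → ∃ y, Disjoint b y ∧ R x y)
    (hext_right : ∀ a b, a₀ ≤ a → b₀ ≤ b → ∀ y, Disjoint b y → ∃ x, Disjoint a x ∧ R x y) :
    ∃ e : α ≃o β, ∀ a, R a (e a) := by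
  classical
  let S : α × β → Prop := fun z => R z.1 z.2
  have hSsup : ∀ z w, S z → S w → Disjoint z w → S (z ⊔ w) := fun z w hz hw hd =>
    hsup _ _ _ _ hz hw (Prod.disjoint_iff.1 hd).1 (Prod.disjoint_iff.1 hd).2
  let T := DisjointFamily S (a₀, b₀)
  have hbase : ∀ s : T, a₀ ≤ (s.parts.sup id).1 ∧ b₀ ≤ (s.parts.sup id).2 := by
    rintro ⟨s, -, -, u, hu, hus⟩
    have : (a₀, b₀) ≤ s.sup id := hus ▸ Finset.sup_mono hu
    exact this
  have step : ∀ (s : T) (l : α × β → α × β) (w : α × β), (∀ z ∈ s.parts, l z ≤ z) →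
      (∀ z ∈ s.parts, S (l z)) → (∀ z ∈ s.parts, S (z \ l z)) → S w → Disjoint (s.parts.sup id) w →
      ∃ t : T, s ≤ t ∧ s.parts.sup l ⊔ w ∈ subSups t.parts := by
    rintro ⟨s, hs, hsS, hs₀⟩ l w hl hSl hSr hw hsw
    obtain ⟨t, ht, htS, hst, hlw⟩ := exists_refinement hs hl hSl hSr hw hsw
    exact ⟨⟨t, ht, htS, subSups_subset hst hs₀⟩, hst, hlw⟩
  have forth : ∀ x : α, IsCofinal {s : T | ∃ z ∈ subSups s.parts, z.1 = x} := by
    intro x s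
    have hy : ∀ z ∈ s.parts, ∃ y ≤ z.2, R (z.1 ⊓ x) y ∧ R (z.1 \ (z.1 ⊓ x)) (z.2 \ y) :=
      fun z hz => hleft z.1 z.2 (s.forall_mem z hz) _ inf_le_left
    choose! y hyz hy₁ hy₂ using hy
    obtain ⟨y', hy', hxy'⟩ := hext_left _ _ (hbase s).1 (hbase s).2 (x \ (s.parts.sup id).1)
      disjoint_sdiff_self_right
    obtain ⟨t, hst, ht⟩ := step s (fun z => (z.1 ⊓ x, y z)) (x \ (s.parts.sup id).1, y')
      (fun z hz => ⟨inf_le_left, hyz z hz⟩) hy₁ hy₂ hxy'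
      (Prod.disjoint_iff.2 ⟨disjoint_sdiff_self_right, hy'⟩)
    refine ⟨t, ⟨_, ht, ?_⟩, hst⟩
    rw [Prod.fst_sup, fst_finset_sup, fst_finset_sup, ← Finset.sup_inf_distrib_right, inf_comm]
    exact sup_inf_sdiff _ _
  have back : ∀ y : β, IsCofinal {s : T | ∃ z ∈ subSups s.parts, z.2 = y} := by
    intro y s
    have hx : ∀ z ∈ s.parts, ∃ x ≤ z.1, R x (z.2 ⊓ y) ∧ R (z.1 \ x) (z.2 \ (z.2 ⊓ y)) :=
      fun z hz => hright z.1 z.2 (s.forall_mem z hz) _ inf_le_left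
    choose! x hxz hx₁ hx₂ using hx
    obtain ⟨x', hx', hxy'⟩ := hext_right _ _ (hbase s).1 (hbase s).2 (y \ (s.parts.sup id).2)
      disjoint_sdiff_self_right
    obtain ⟨t, hst, ht⟩ := step s (fun z => (x z, z.2 ⊓ y)) (x', y \ (s.parts.sup id).2)
      (fun z hz => ⟨hxz z hz, inf_le_left⟩) hx₁ hx₂ hxy'
      (Prod.disjoint_iff.2 ⟨hx', disjoint_sdiff_self_right⟩)
    refine ⟨t, ⟨_, ht, ?_⟩, hst⟩
    rw [Prod.snd_sup, snd_finset_sup, snd_finset_sup, ← Finset.sup_inf_distrib_right, inf_comm]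
    exact sup_inf_sdiff _ _
  let s₀ : T := ⟨{(a₀, b₀)}, by simp, by simpa [S] using h₀, mem_subSups_of_mem (by simp)⟩
  let 𝒟 : α ⊕ β → Order.Cofinal T :=
    Sum.elim (fun x => ⟨_, forth x⟩) (fun y => ⟨_, back y⟩)
  have := Encodable.ofCountable (α ⊕ β)
  let J := Order.idealOfCofinals s₀ 𝒟
  let M : Set (α × β) := {z | ∃ s ∈ J, z ∈ subSups s.parts}
  have hMl : ∀ x, ∃ y, (x, y) ∈ M := fun x => by
    obtain ⟨s, ⟨z, hz, rfl⟩, hsJ⟩ := Order.cofinal_meets_idealOfCofinals s₀ 𝒟 (Sum.inl x)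
    exact ⟨z.2, s, hsJ, hz⟩
  have hMr : ∀ y, ∃ x, (x, y) ∈ M := fun y => by
    obtain ⟨s, ⟨z, hz, rfl⟩, hsJ⟩ := Order.cofinal_meets_idealOfCofinals s₀ 𝒟 (Sum.inr y)
    exact ⟨z.1, s, hsJ, hz⟩
  have hMS : ∀ z ∈ M, S z := fun z ⟨s, _, hz⟩ =>
    subSups_induction s.pairwiseDisjoint hbot hSsup s.forall_mem hz
  have hMd : ∀ z ∈ M, ∀ w ∈ M, z \ w ∈ M := by
    rintro z ⟨s, hs, hz⟩ w ⟨t, ht, hw⟩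
    obtain ⟨u, hu, hsu, htu⟩ := J.directed s hs t ht
    exact ⟨u, hu, sdiff_mem_subSups u.pairwiseDisjoint
      (subSups_subset hsu hz) (subSups_subset htu hw)⟩
  have hMle : ∀ z ∈ M, ∀ w ∈ M, z.1 ≤ w.1 ↔ z.2 ≤ w.2 := fun z hz w hw => by
    rw [← sdiff_eq_bot_iff, ← sdiff_eq_bot_iff]
    exact hbot_iff _ _ (hMS _ (hMd z hz w hw))
  choose e he using hMl
  have hsurj : Function.Surjective e := fun y => by
    obtain ⟨x, hx⟩ := hMr y
    exact ⟨x, le_antisymm ((hMle _ (he x) _ hx).1 le_rfl) ((hMle _ hx _ (he x)).1 le_rfl)⟩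
  exact ⟨RelIso.ofSurjective (OrderEmbedding.ofMapLEIff e fun a b => (hMle _ (he a) _ (he b)).symm)
    hsurj, fun a => hMS _ (he a)⟩

end BackAndForth

section CompactOpens

variable {W' : Type*} [TopologicalSpace W']

theorem TopologicalSpace.CompactOpens.countable [SecondCountableTopology W] :
    Countable (CompactOpens W) := by
  have hb := isBasis_countableBasis W
  have : Countable (countableBasis W) := (countable_countableBasis W).to_subtype
  have H : ∀ A : CompactOpens W, ∃ s : Finset (countableBasis W),
      (A : Set W) = ⋃₀ ((↑) '' (s : Set (countableBasis W)) : Set (Set W)) := fun A => by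
    obtain ⟨s, hs⟩ := eq_sUnion_finset_of_isTopologicalBasis_of_isCompact_open _ hb (A : Set W)
      A.isCompact A.isOpen
    exact ⟨s, hs⟩
  choose s hs using H
  refine Function.Injective.countable (f := s) fun A B h => ?_
  apply SetLike.coe_injective
  rw [hs A, hs B, h]

theorem exists_forall_mem_iff_mem_orderIso [T2Space W] [T2Space W']
    (hW : ∀ w : W, ∀ U ∈ nhds w, ∃ A : CompactOpens W, w ∈ A ∧ (A : Set W) ⊆ U)
    (e : CompactOpens W ≃o CompactOpens W') (w : W) :
    ∃ w' : W', ∀ A, w ∈ A ↔ w' ∈ e A := by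
  obtain ⟨A₀, hA₀, -⟩ := hW w univ Filter.univ_mem
  have hne : (⋂ A : {A : CompactOpens W // w ∈ A}, (e A.1 : Set W')).Nonempty := by
    have : Nonempty {A : CompactOpens W // w ∈ A} := ⟨⟨A₀, hA₀⟩⟩
    refine IsCompact.nonempty_iInter_of_directed_nonempty_isCompact_isClosed _ ?_ ?_
      (fun A => (e A.1).isCompact) fun A => (e A.1).isCompact.isClosed
    · intro A B
      refine ⟨⟨A.1 ⊓ B.1, A.2, B.2⟩, ?_, ?_⟩
      · exact e.monotone inf_le_left
      · exact e.monotone inf_le_right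
    · intro A
      by_contra h
      rw [not_nonempty_iff_eq_empty] at h
      have h1 : e A.1 = ⊥ := SetLike.coe_injective h
      rw [map_eq_bot_iff] at h1
      have h2 := A.2
      rw [h1] at h2
      exact h2
  obtain ⟨w', hw'⟩ := hne
  rw [mem_iInter] at hw'
  refine ⟨w', fun A => ⟨fun h => hw' ⟨A, h⟩, fun h => ?_⟩⟩
  by_contra hA
  have h1 : w' ∈ e (A₀ \ A) := hw' ⟨A₀ \ A, hA₀, hA⟩
  have h2 : Disjoint (e (A₀ \ A)) (e A) := disjoint_sdiff_self_left.map_orderIso e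
  exact Set.disjoint_left.1 (CompactOpens.disjoint_coe h2) h1 h

theorem eq_of_forall_mem_compactOpens_iff [T2Space W]
    (hW : ∀ w : W, ∀ U ∈ nhds w, ∃ A : CompactOpens W, w ∈ A ∧ (A : Set W) ⊆ U) {x y : W}
    (h : ∀ A : CompactOpens W, x ∈ A ↔ y ∈ A) : x = y := by
  by_contra hne
  obtain ⟨A, hx, hA⟩ := hW x {y}ᶜ (isOpen_compl_singleton.mem_nhds hne)
  exact hA ((h A).1 hx) rfl

theorem exists_homeomorph_of_orderIso [T2Space W] [T2Space W']
    (hW : ∀ w : W, ∀ U ∈ nhds w, ∃ A : CompactOpens W, w ∈ A ∧ (A : Set W) ⊆ U)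
    (hW' : ∀ w : W', ∀ U ∈ nhds w, ∃ A : CompactOpens W', w ∈ A ∧ (A : Set W') ⊆ U)
    (e : CompactOpens W ≃o CompactOpens W') :
    ∃ h : W ≃ₜ W', ∀ w A, w ∈ A ↔ h w ∈ e A := by
  choose f hf using exists_forall_mem_iff_mem_orderIso hW e
  choose g hg using exists_forall_mem_iff_mem_orderIso hW' e.symm
  have hg' : ∀ w' A, g w' ∈ A ↔ w' ∈ e A := fun w' A => by
    rw [hg w' (e A), e.symm_apply_apply]
  refine ⟨⟨⟨f, g, fun w => ?_, fun w' => ?_⟩, ?_, ?_⟩, hf⟩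
  · exact eq_of_forall_mem_compactOpens_iff hW fun A => by rw [hg', ← hf]
  · refine eq_of_forall_mem_compactOpens_iff hW' fun A => ?_
    rw [hg w' A, hf, e.apply_symm_apply]
  · change Continuous f
    refine continuous_iff_continuousAt.2 fun w U hU => ?_
    obtain ⟨A, hwA, hAU⟩ := hW' _ U hU
    rw [Filter.mem_map]
    refine Filter.mem_of_superset ((e.symm A).isOpen.mem_nhds (x := w) ?_) fun y hy => hAU ?_
    · change w ∈ e.symm A
      rw [hf, e.apply_symm_apply]; exact hwA
    · have : y ∈ e.symm A := hy
      rw [hf, e.apply_symm_apply] at this; exact this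
  · change Continuous g
    refine continuous_iff_continuousAt.2 fun w U hU => ?_
    obtain ⟨A, hwA, hAU⟩ := hW _ U hU
    rw [Filter.mem_map]
    refine Filter.mem_of_superset ((e A).isOpen.mem_nhds (x := w) ?_) fun y hy => hAU ?_
    · exact (hg' _ _).1 hwA
    · exact (hg' _ _).2 hy

end CompactOpens

section Uniqueness

variable {W' : Type*} [TopologicalSpace W'] {X : P → Set W} {X' : P → Set W'} {Q I : Set P}

theorem IsTrimPartition.exists_compactOpens_subset (hX : IsTrimPartition X) (w : W) {U : Set W}
    (hU : U ∈ nhds w) : ∃ A : CompactOpens W, w ∈ A ∧ (A : Set W) ⊆ U := by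
  obtain ⟨p, A, hA, hwA, hAU⟩ := hX.2.1 w U hU
  exact ⟨⟨⟨A, hA.1⟩, hA.2.1⟩, hwA, hAU⟩

theorem IsTrimPartition.exists_compactOpens_ptype_eq [T2Space W] (hX : IsTrimPartition X)
    (hQ : IsLowerSet Q) {K₀ : Set W} (hK₀ : IsCompact K₀) (h : (⋃ q ∈ Q, X q) ⊆ K₀) :
    ∃ K : CompactOpens W, (∀ q ∈ Q, X q ⊆ K) ∧ ptype X K = {p | ∃ q ∈ Q, q ≤ p} := by
  have hZ : IsCompact (closure (⋃ q ∈ Q, X q)) := hK₀.closure_of_subset h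
  have H : ∀ x : W, ∃ A : CompactOpens W, x ∈ A ∧ ∃ p, IsTrimSet X p A := fun x => by
    obtain ⟨p, A, hA, hxA, -⟩ := hX.2.1 x univ Filter.univ_mem
    exact ⟨⟨⟨A, hA.1⟩, hA.2.1⟩, hxA, p, hA⟩
  choose A hxA p hA using H
  obtain ⟨t, htZ, ht⟩ := hZ.elim_nhds_subcover (fun x => (A x : Set W))
    fun x _ => (A x).isOpen.mem_nhds (hxA x)
  have hsub : ∀ q ∈ Q, X q ⊆ (t.sup A : CompactOpens W) := fun q hq => by
    rw [CompactOpens.coe_finsetSup]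
    exact (subset_biUnion_of_mem (u := fun q => X q) hq).trans (subset_closure.trans ht)
  refine ⟨t.sup A, hsub, Subset.antisymm ?_ ?_⟩
  · rw [ptype_finset_sup]
    refine iUnion₂_subset fun x hx r hr => ?_
    obtain ⟨y, hyA, hy⟩ := mem_closure_iff.1 (htZ x hx) (A x) (A x).isOpen (hxA x)
    obtain ⟨q, hq, hyq⟩ := mem_iUnion₂.1 hy
    have hpq : q ∈ ptype X (A x) := ⟨y, hyA, hyq⟩
    rw [(hA x).2.2] at hpq hr
    exact ⟨p x, hQ hpq hq, hr⟩
  · rintro r ⟨q, hq, hqr⟩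
    refine hX.isUpperSet_ptype (t.sup A).isOpen hqr ?_
    obtain ⟨y, hy⟩ := hX.1.nonempty q
    exact ⟨y, hsub q hq hy, hy⟩

theorem countEq_of_ptype_eq [T2Space W] [T2Space W'] (hX : IsTrimPartition X)
    (hX' : IsTrimPartition X') (hI : IsIsolatedFamily I X) (hI' : IsIsolatedFamily I X')
    (hQ : IsLowerSet Q) {K : CompactOpens W} {K' : CompactOpens W'} (hK : ∀ q ∈ Q, X q ⊆ K)
    (hK' : ∀ q ∈ Q, X' q ⊆ K') (hT : ptype X K = {p | ∃ q ∈ Q, q ≤ p})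
    (hT' : ptype X' K' = {p | ∃ q ∈ Q, q ≤ p}) : CountEq X X' K K' := by
  intro p
  by_cases hp : ∃ q ∈ Q, q ≤ p
  · have hpK : p ∈ ptype X K := hT ▸ hp
    have hpK' : p ∈ ptype X' K' := hT' ▸ hp
    obtain ⟨q, hq, hqp⟩ := hp
    by_cases hlt : ∃ r ∈ Q, r < p
    · obtain ⟨r, hr, hrp⟩ := hlt
      rw [(hX.infinite_of_lt K.isOpen (p := r) (hT ▸ ⟨r, hr, le_rfl⟩) hrp).encard_eq,
        (hX'.infinite_of_lt K'.isOpen (p := r) (hT' ▸ ⟨r, hr, le_rfl⟩) hrp).encard_eq]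
    · push Not at hlt
      obtain rfl : q = p := hqp.eq_of_not_lt (hlt q hq)
      have hmin : IsMin q := fun r hr => by
        by_contra hn
        exact hlt r (hQ hr hq) (lt_of_le_not_ge hr hn)
      by_cases hqI : q ∈ I
      · obtain ⟨x, hx⟩ := hI.2.2 q hqI hmin
        obtain ⟨x', hx'⟩ := hI'.2.2 q hqI hmin
        rw [inter_eq_right.2 (hK q hq), inter_eq_right.2 (hK' q hq), hx, hx', encard_singleton,
          encard_singleton]
      · rw [(hI.infinite_of_notMem hqI K.isOpen hpK).encard_eq,
          (hI'.infinite_of_notMem hqI K'.isOpen hpK').encard_eq]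
  · have h1 : p ∉ ptype X K := by rwa [hT]
    have h2 : p ∉ ptype X' K' := by rwa [hT']
    rw [mem_ptype_iff_encard_ne_zero, not_not] at h1 h2
    rw [h1, h2]

theorem exists_disjoint_countEq [T2Space W] [T2Space W'] (hX : IsTrimPartition X)
    (hX' : IsTrimPartition X') (hI : IsIsolatedFamily I X) (hI' : IsIsolatedFamily I X')
    (hnc : ∀ p ∉ Q, ¬ IsCompact (closure (X' p))) {A B : CompactOpens W} {A' : CompactOpens W'}
    (hA : ∀ q ∈ Q, X q ⊆ A) (hAB : Disjoint A B) :
    ∃ B' : CompactOpens W', Disjoint A' B' ∧ CountEq X X' B B' := by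
  obtain ⟨B', hB', h⟩ := exists_countEq_of_forall_infinite hX hX' hI hI' B
    A'.isCompact.isClosed.isOpen_compl fun E _ g hg hfin => by
      have hgQ : g ∉ Q := fun hgQ => by
        obtain ⟨x, hxB, hxg⟩ := hg
        exact Set.disjoint_left.1 (CompactOpens.disjoint_coe hAB) (hA g hgQ hxg) hxB
      refine hnc g hgQ ((((A'.isCompact.union E.isCompact).union
        hfin.isCompact)).closure_of_subset fun x hx => ?_)
      by_cases hxA : x ∈ (A' : Set W')
      · exact Or.inl (Or.inl hxA)
      · by_cases hxE : x ∈ (E : Set W')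
        · exact Or.inl (Or.inr hxE)
        · exact Or.inr ⟨⟨hxA, hxE⟩, hx⟩
  refine ⟨B', ?_, h⟩
  rw [disjoint_iff]
  apply SetLike.coe_injective
  exact disjoint_iff_inter_eq_empty.1 (disjoint_compl_right.mono_right hB')

theorem exists_orderIso_countEq [T2Space W] [T2Space W'] [SecondCountableTopology W]
    [SecondCountableTopology W'] (hQ : IsLowerSet Q) (hX : Stmt18Partition Q I X)
    (hX' : Stmt18Partition Q I X') :
    ∃ e : CompactOpens W ≃o CompactOpens W', ∀ A : CompactOpens W, CountEq X X' A (e A) := by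
  obtain ⟨hX, ⟨K₀, hK₀, hQK₀⟩, hnc, hI⟩ := hX
  obtain ⟨hX', ⟨K₀', hK₀', hQK₀'⟩, hnc', hI'⟩ := hX'
  obtain ⟨K, hK, hT⟩ := hX.exists_compactOpens_ptype_eq hQ hK₀ hQK₀
  obtain ⟨K', hK', hT'⟩ := hX'.exists_compactOpens_ptype_eq hQ hK₀' hQK₀'
  have := CompactOpens.countable (W := W)
  have := CompactOpens.countable (W := W')
  refine exists_orderIso_of_backAndForth
    (fun (A : CompactOpens W) (A' : CompactOpens W') => CountEq X X' (A : Set W) (A' : Set W'))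
    CountEq.empty ?_ ?_ ?_ ?_ K K' (countEq_of_ptype_eq hX hX' hI hI' hQ hK hK' hT hT') ?_ ?_
  · intro A A' h
    have := h.eq_empty_iff hX hX' A.isOpen A'.isOpen
    rwa [← CompactOpens.coe_bot, ← CompactOpens.coe_bot, SetLike.coe_set_eq,
      SetLike.coe_set_eq] at this
  · intro A A' B B' h h' hd hd'
    exact h.union h' (CompactOpens.disjoint_coe hd) (CompactOpens.disjoint_coe hd')
  · intro A A' h B hB
    exact h.exists_split hX hX' hI hI' hB
  · intro A A' h B' hB'
    obtain ⟨B, hB, h1, h2⟩ := h.symm.exists_split hX' hX hI' hI hB'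
    exact ⟨B, hB, h1.symm, h2.symm⟩
  · intro A A' hA _ B hB
    exact exists_disjoint_countEq hX hX' hI hI' hnc' (fun q hq => (hK q hq).trans hA) hB
  · intro A A' _ hA' B' hB'
    obtain ⟨B, hB, h⟩ := exists_disjoint_countEq hX' hX hI' hI hnc (A' := A)
      (fun q hq => (hK' q hq).trans hA') hB'
    exact ⟨B, hB, h.symm⟩

theorem image_subset_of_countEq (hX : IsTrimPartition X) (hX' : IsTrimPartition X')
    {e : CompactOpens W ≃o CompactOpens W'} (he : ∀ A : CompactOpens W, CountEq X X' A (e A))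
    {h : W → W'} (hh : ∀ w A, w ∈ A ↔ h w ∈ e A) {p : P} {x : W} (hx : x ∈ X p) : h x ∈ X' p := by
  refine hX'.2.2.2 p _ fun U hU => ?_
  obtain ⟨A', hxA', hA'U⟩ := hX'.exists_compactOpens_subset _ hU
  have hxA : x ∈ e.symm A' := by rwa [hh, e.apply_symm_apply]
  obtain ⟨B, hB, hxB, hBA⟩ := hX.exists_trim_subset (e.symm A').isOpen hxA hx
  let B₁ : CompactOpens W := ⟨⟨B, hB.1⟩, hB.2.1⟩
  refine ⟨e B₁, (he B₁).isTrimSet hB (e B₁).isCompact (e B₁).isOpen, (hh x B₁).1 hxB,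
    Subset.trans ?_ hA'U⟩
  have : e B₁ ≤ A' := by
    rw [← e.le_symm_apply]
    exact hBA
  exact this

theorem exists_homeomorph_of_stmt18Partition [T2Space W] [T2Space W'] [SecondCountableTopology W]
    [SecondCountableTopology W'] (hQ : IsLowerSet Q) (hX : Stmt18Partition Q I X)
    (hX' : Stmt18Partition Q I X') : ∃ h : W ≃ₜ W', ∀ p, h '' X p = X' p := by
  obtain ⟨e, he⟩ := exists_orderIso_countEq hQ hX hX'
  obtain ⟨h, hh⟩ := exists_homeomorph_of_orderIso
    (fun w _ hU => hX.1.exists_compactOpens_subset w hU)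
    (fun w _ hU => hX'.1.exists_compactOpens_subset w hU) e
  refine ⟨h, fun p => Subset.antisymm ?_ fun y hy => ⟨h.symm y, ?_, h.apply_symm_apply y⟩⟩
  · rintro _ ⟨x, hx, rfl⟩
    exact image_subset_of_countEq hX.1 hX'.1 he hh hx
  · refine image_subset_of_countEq hX'.1 hX.1 (e := e.symm) (h := h.symm) (fun A' => ?_)
      (fun w A' => ?_) hy
    · have := (he (e.symm A')).symm
      rwa [e.apply_symm_apply] at this
    · rw [hh, e.apply_symm_apply, h.apply_symm_apply]

end Uniqueness

section PathSpace

variable {S : Set ℕ} {π : S ≃ P} {Q I F : Set P}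

/-- Initial states of paths: a single one for each label in `F`, and infinitely many for each
label outside `Q`. -/
def IsPathRoot (π : S ≃ P) (Q F : Set P) (s : ℕ × S) : Prop :=
  (π s.2 ∈ F ∧ s.1 = 0) ∨ π s.2 ∉ Q

/-- The allowed steps of paths at time `n`: the label `π s.2` stays the same or increases to one
of finitely many labels, and the first entry is a bit, which vanishes at labels in `I`. -/
def IsPathStep (π : S ≃ P) (I : Set P) (n : ℕ) (s t : ℕ × S) : Prop :=
  (t.2 = s.2 ∨ π s.2 < π t.2 ∧ (t.2 : ℕ) ≤ n) ∧ t.1 ≤ 1 ∧ (π t.2 ∈ I → t.1 = 0)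

/-- The set of infinite paths. -/
def pathSet (π : S ≃ P) (Q I F : Set P) : Set (ℕ → ℕ × S) :=
  {w | IsPathRoot π Q F (w 0) ∧ ∀ n, IsPathStep π I n (w n) (w (n + 1))}

/-- The paths whose label is eventually `p`. -/
def pathPart (π : S ≃ P) (Q I F : Set P) (p : P) : Set (pathSet π Q I F) :=
  {w | ∃ n, ∀ m ≥ n, π (w.1 m).2 = p}

/-- The paths which agree with `w` up to time `n`. -/
def pathCylinder (w : pathSet π Q I F) (n : ℕ) : Set (pathSet π Q I F) :=
  {v | ∀ i ≤ n, v.1 i = w.1 i}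

theorem mem_pathCylinder_self (w : pathSet π Q I F) (n : ℕ) : w ∈ pathCylinder w n :=
  fun _ _ => rfl

theorem monotone_label (w : pathSet π Q I F) : Monotone fun n => π (w.1 n).2 :=
  monotone_nat_of_le_succ fun n => by
    rcases (w.2.2 n).1 with h | h
    · rw [h]
    · exact h.1.le

theorem label_le_of_mem_pathPart {w : pathSet π Q I F} {p : P} (hw : w ∈ pathPart π Q I F p)
    (n : ℕ) : π (w.1 n).2 ≤ p := by
  obtain ⟨m, hm⟩ := hw
  rw [← hm (max n m) (le_max_right _ _)]
  exact monotone_label w (le_max_left _ _)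

theorem finite_setOf_isPathStep (n : ℕ) (s : ℕ × S) : {t | IsPathStep π I n s t}.Finite := by
  have h : ({t : S | t = s.2 ∨ (t : ℕ) ≤ n}).Finite :=
    (finite_singleton s.2).union
      ((finite_Iic n).preimage Subtype.val_injective.injOn)
  refine ((finite_Iic 1).prod h).subset fun t ht => ⟨ht.2.1, ?_⟩
  exact ht.1.imp id And.right

theorem isClosed_pathSet : IsClosed (pathSet π Q I F) := by
  have h : pathSet π Q I F = (fun w => w 0) ⁻¹' {s | IsPathRoot π Q F s} ∩
      ⋂ n, (fun w => (w n, w (n + 1))) ⁻¹' {z | IsPathStep π I n z.1 z.2} := by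
    ext w
    simp [pathSet]
  rw [h]
  exact ((isClosed_discrete _).preimage (by fun_prop)).inter
    (isClosed_iInter fun n => (isClosed_discrete _).preimage (by fun_prop))

theorem continuous_coe_apply (i : ℕ) : Continuous fun w : pathSet π Q I F => w.1 i :=
  (continuous_apply i).comp continuous_subtype_val

theorem isCompact_setOf_root_eq (s : ℕ × S) : IsCompact {w : pathSet π Q I F | w.1 0 = s} := by
  let T : ℕ → Set (ℕ × S) := fun n =>
    Nat.rec {s} (fun n Tn => ⋃ u ∈ Tn, {t | IsPathStep π I n u t}) n
  have hT : ∀ n, (T n).Finite := fun n => by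
    induction n with
    | zero => exact finite_singleton s
    | succ n ih => exact ih.biUnion fun u _ => finite_setOf_isPathStep n u
  have hcl : IsClosed {w : pathSet π Q I F | w.1 0 = s} :=
    isClosed_eq (continuous_coe_apply 0) continuous_const
  rw [Subtype.isCompact_iff]
  refine (isCompact_univ_pi fun n => (hT n).isCompact).of_isClosed_subset
    (isClosed_pathSet.isClosedEmbedding_subtypeVal.isClosedMap _ hcl) ?_
  rintro _ ⟨w, hw, rfl⟩ n -
  induction n with
  | zero => exact hw
  | succ n ih => exact mem_biUnion ih (w.2.2 n)

theorem isClopen_pathCylinder (w : pathSet π Q I F) (n : ℕ) : IsClopen (pathCylinder w n) := by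
  have h : pathCylinder w n =
      ⋂ i ∈ Iic n, (fun v : pathSet π Q I F => v.1 i) ⁻¹' {w.1 i} := by
    ext v
    simp [pathCylinder]
  rw [h]
  exact (finite_Iic n).isClopen_biInter fun i _ =>
    (isClopen_discrete _).preimage (continuous_coe_apply i)

theorem isCompact_pathCylinder (w : pathSet π Q I F) (n : ℕ) : IsCompact (pathCylinder w n) :=
  (isCompact_setOf_root_eq (w.1 0)).of_isClosed_subset (isClopen_pathCylinder w n).isClosed
    fun _ hv => hv 0 (Nat.zero_le n)

theorem exists_pathCylinder_subset (w : pathSet π Q I F) {U : Set (pathSet π Q I F)}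
    (hU : U ∈ nhds w) : ∃ n, ∀ m ≥ n, pathCylinder w m ⊆ U := by
  rw [nhds_subtype_eq_comap] at hU
  obtain ⟨V, hV, hVU⟩ := hU
  obtain ⟨_, ⟨x, n, rfl⟩, hw, hnV⟩ :=
    (PiNat.isTopologicalBasis_cylinders fun _ : ℕ => ℕ × S).mem_nhds_iff.1 hV
  refine ⟨n, fun m hm v hv => hVU (hnV fun i hi => ?_)⟩
  rw [hv i (hi.le.trans hm), hw i hi]

theorem exists_mem_pathPart_eqOn (w : ℕ → ℕ × S) (n : ℕ) (h₀ : IsPathRoot π Q F (w 0))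
    (h : ∀ i < n, IsPathStep π I i (w i) (w (i + 1))) {q : P} (hq : π (w n).2 ≤ q) :
    ∃ v ∈ pathPart π Q I F q, ∀ i ≤ n, v.1 i = w i := by
  let M := max n (π.symm q)
  let v : ℕ → ℕ × S := fun i => if i ≤ n then w i else (0, if i ≤ M then (w n).2 else π.symm q)
  have hv : ∀ i ≤ n, v i = w i := fun i hi => if_pos hi
  have hv' : ∀ i, n < i → v i = (0, if i ≤ M then (w n).2 else π.symm q) :=
    fun i hi => if_neg hi.not_ge
  have hvM : ∀ i, n ≤ i → i ≤ M → (v i).2 = (w n).2 := fun i hi hiM => by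
    rcases hi.eq_or_lt with rfl | hi
    · rw [hv _ le_rfl]
    · rw [hv' i hi, if_pos hiM]
  have hnM : n ≤ M := le_max_left _ _
  have hvq : ∀ i, M < i → (v i).2 = π.symm q := fun i hi => by
    rw [hv' i (hnM.trans_lt hi), if_neg hi.not_ge]
  have hmem : v ∈ pathSet π Q I F := by
    refine ⟨by rwa [hv 0 (Nat.zero_le n)], fun i => ?_⟩
    rcases lt_or_ge i n with hi | hi
    · rw [hv i hi.le, hv (i + 1) hi]
      exact h i hi
    · have h1 : (v (i + 1)).1 = 0 := by rw [hv' _ (Nat.lt_succ_of_le hi)]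
      refine ⟨?_, by rw [h1]; exact Nat.zero_le 1, fun _ => h1⟩
      rcases lt_or_ge i M with hiM | hiM
      · left
        rw [hvM i hi hiM.le, hvM (i + 1) (hi.trans (Nat.le_succ i)) hiM]
      · rw [hvq (i + 1) (Nat.lt_succ_of_le hiM), π.apply_symm_apply]
        rcases hiM.eq_or_lt with rfl | hiM
        · rw [hvM M hi le_rfl]
          rcases hq.eq_or_lt with rfl | hq
          · left
            rw [π.symm_apply_apply]
          · exact Or.inr ⟨hq, le_max_right _ _⟩
        · left
          rw [hvq i hiM]
  refine ⟨⟨v, hmem⟩, ⟨M + 1, fun m hm => ?_⟩, hv⟩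
  change π (v m).2 = q
  rw [hvq m hm, π.apply_symm_apply]

theorem isTrimSet_pathCylinder (w : pathSet π Q I F) (n : ℕ) :
    IsTrimSet (pathPart π Q I F) (π (w.1 n).2) (pathCylinder w n) := by
  refine ⟨isCompact_pathCylinder w n, (isClopen_pathCylinder w n).isOpen,
    Subset.antisymm ?_ fun q hq => ?_⟩
  · rintro q ⟨v, hv, hvq⟩
    rw [mem_Ici, ← hv n le_rfl]
    exact label_le_of_mem_pathPart hvq n
  · obtain ⟨v, hvq, hv⟩ := exists_mem_pathPart_eqOn (I := I) w.1 n w.2.1 (fun i _ => w.2.2 i) hq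
    exact ⟨v, hv, hvq⟩

theorem isTrimPartition_pathPart (hF : ∀ q ∈ Q, ∃ p ∈ F, p ≤ q) :
    IsTrimPartition (pathPart π Q I F) := by
  refine ⟨⟨fun p => ?_, fun p q hpq => ?_⟩, fun w U hU => ?_, fun p w ⟨n, hn⟩ => ?_,
    fun p w hw => ?_⟩
  · have : ∃ s, IsPathRoot π Q F s ∧ π s.2 ≤ p := by
      by_cases hp : p ∈ Q
      · obtain ⟨f, hf, hfp⟩ := hF p hp
        exact ⟨(0, π.symm f), Or.inl ⟨by simpa, rfl⟩, by simpa⟩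
      · exact ⟨(0, π.symm p), Or.inr (by simpa), by simp⟩
    obtain ⟨s, hs, hsp⟩ := this
    obtain ⟨v, hv, -⟩ := exists_mem_pathPart_eqOn (I := I) (fun _ => s) 0 hs (by simp) hsp
    exact ⟨v, hv⟩
  · refine Set.disjoint_left.2 fun w ⟨m, hm⟩ ⟨n, hn⟩ => hpq ?_
    rw [← hm _ (le_max_left m n), ← hn _ (le_max_right m n)]
  · obtain ⟨n, hn⟩ := exists_pathCylinder_subset w hU
    exact ⟨_, _, isTrimSet_pathCylinder w n, mem_pathCylinder_self w n, hn n le_rfl⟩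
  · refine ⟨pathCylinder w n, ?_, mem_pathCylinder_self w n⟩
    have := isTrimSet_pathCylinder w n
    rwa [hn n le_rfl] at this
  · have key : ∀ n, π (w.1 n).2 ≤ p ∧ ∃ m, p ≤ π (w.1 m).2 := fun n => by
      obtain ⟨A, hA, hwA, hAn⟩ :=
        hw _ ((isClopen_pathCylinder w n).isOpen.mem_nhds (mem_pathCylinder_self w n))
      obtain ⟨m, hm⟩ := exists_pathCylinder_subset w (hA.2.1.mem_nhds hwA)
      have h1 := ptype_mono (pathPart π Q I F) hAn hA.mem_ptype
      have h2 := ptype_mono (pathPart π Q I F) (hm m le_rfl)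
        (isTrimSet_pathCylinder w m).mem_ptype
      rw [(isTrimSet_pathCylinder w n).2.2] at h1
      rw [hA.2.2] at h2
      exact ⟨h1, m, h2⟩
    obtain ⟨m, hm⟩ := (key 0).2
    exact ⟨m, fun j hj => (key j).1.antisymm (hm.trans (monotone_label w hj))⟩

theorem eq_of_label_eq {v w : pathSet π Q I F} {p : P} (hp : p ∈ I) {n : ℕ}
    (hv : ∀ m ≥ n, π (v.1 m).2 = p) (hw : ∀ m ≥ n, π (w.1 m).2 = p)
    (h : ∀ i ≤ n, v.1 i = w.1 i) : v = w := by
  refine Subtype.ext (funext fun i => ?_)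
  rcases le_or_gt i n with hi | hi
  · exact h i hi
  · obtain ⟨i, rfl⟩ := Nat.exists_eq_add_of_lt hi
    have hvi := hv (n + i + 1) hi.le
    have hwi := hw (n + i + 1) hi.le
    refine Prod.ext ?_ (π.injective (hvi.trans hwi.symm))
    rw [(v.2.2 (n + i)).2.2 (by rwa [hvi]), (w.2.2 (n + i)).2.2 (by rwa [hwi])]

theorem isIsolatedFamily_pathPart (hF : ∀ q ∈ Q, ∃ p ∈ F, p ≤ q)
    (hIQ : ∀ p ∈ I, IsMin p → p ∈ Q) : IsIsolatedFamily I (pathPart π Q I F) := by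
  refine ⟨?_, ?_, ?_⟩
  · rintro p hp w ⟨k, hk⟩ ⟨U, hU, hUw⟩
    have hwU : w ∈ U := (hUw.ge rfl).1
    obtain ⟨n, hn⟩ := exists_pathCylinder_subset w (hU.mem_nhds hwU)
    let N := max k n
    let v : ℕ → ℕ × S := Function.update w.1 (N + 1) (1 - (w.1 (N + 1)).1, (w.1 (N + 1)).2)
    have hv2 : ∀ i, (v i).2 = (w.1 i).2 := fun i => by
      by_cases hi : i = N + 1
      · subst hi
        simp [v]
      · simp [v, hi]
    have hv : ∀ i, i ≠ N + 1 → v i = w.1 i := fun i hi => by simp [v, hi]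
    have hmem : v ∈ pathSet π Q I F := by
      refine ⟨by rw [hv 0 (by simp)]; exact w.2.1, fun i => ?_⟩
      obtain ⟨h1, h2, h3⟩ := w.2.2 i
      refine ⟨by rwa [hv2, hv2], ?_⟩
      rw [hv2]
      by_cases hi : i = N
      · subst hi
        refine ⟨by simp [v], fun hI => absurd ?_ hp⟩
        rwa [hk (N + 1) ((le_max_left k n).trans (Nat.le_succ N))] at hI
      · rw [hv (i + 1) (by simpa using hi)]
        exact ⟨h2, h3⟩
    have hvw : (⟨v, hmem⟩ : pathSet π Q I F) ∈ U ∩ pathPart π Q I F p := by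
      refine ⟨hn N (le_max_right k n) fun i hi => hv i (by lia), k, fun m hm => ?_⟩
      change π (v m).2 = p
      rw [hv2, hk m hm]
    rw [hUw, mem_singleton_iff, Subtype.ext_iff] at hvw
    have h1 : (v (N + 1)).1 = (w.1 (N + 1)).1 := by rw [← hvw]
    have h2 : (v (N + 1)).1 = 1 - (w.1 (N + 1)).1 := by simp [v]
    have h3 := (w.2.2 N).2.1
    lia
  · rintro p hp w ⟨n, hn⟩
    refine ⟨pathCylinder w n, (isClopen_pathCylinder w n).isOpen, Subset.antisymm ?_ ?_⟩
    · rintro v ⟨hv, hvp⟩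
      refine eq_of_label_eq hp (fun m hm => (label_le_of_mem_pathPart hvp m).antisymm ?_) hn hv
      rw [← hn n le_rfl, ← hv n le_rfl]
      exact monotone_label v hm
    · rintro _ rfl
      exact ⟨mem_pathCylinder_self _ n, n, hn⟩
  · intro p hp hmin
    obtain ⟨w, hw⟩ := (isTrimPartition_pathPart (π := π) (I := I) hF).1.nonempty p
    have hlab : ∀ v ∈ pathPart π Q I F p, ∀ m, π (v.1 m).2 = p := fun v hv m =>
      hmin.eq_of_le (label_le_of_mem_pathPart hv m)
    have hroot : ∀ v ∈ pathPart π Q I F p, (v.1 0).1 = 0 := fun v hv => by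
      rcases v.2.1 with h | h
      · exact h.2
      · rw [hlab v hv] at h
        exact absurd (hIQ p hp hmin) h
    refine ⟨w, Subset.antisymm (fun v hv => ?_) (singleton_subset_iff.2 hw)⟩
    refine eq_of_label_eq hp (fun m _ => hlab v hv m) (fun m _ => hlab w hw m) (n := 0)
      fun i hi => ?_
    obtain rfl := Nat.le_zero.1 hi
    exact Prod.ext ((hroot v hv).trans (hroot w hw).symm)
      (π.injective ((hlab v hv 0).trans (hlab w hw 0).symm))

theorem stmt18Partition_pathPart (hQ : IsLowerSet Q) (hFf : F.Finite)
    (hF : ∀ q ∈ Q, ∃ p ∈ F, p ≤ q) (hIQ : ∀ p ∈ I, IsMin p → p ∈ Q) :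
    Stmt18Partition Q I (pathPart π Q I F) := by
  refine ⟨isTrimPartition_pathPart hF, ?_, fun p hp hc => ?_, isIsolatedFamily_pathPart hF hIQ⟩
  · refine ⟨⋃ f ∈ F, {w : pathSet π Q I F | w.1 0 = (0, π.symm f)},
      hFf.isCompact_biUnion fun f _ => isCompact_setOf_root_eq _,
      iUnion₂_subset fun q hq w hw => ?_⟩
    rcases w.2.1 with h | h
    · exact mem_biUnion h.1 (Prod.ext h.2 (π.symm_apply_apply _).symm)
    · exact absurd (hQ (label_le_of_mem_pathPart hw 0) hq) h
  · have hfin : ((fun w : pathSet π Q I F => (w.1 0).1) '' closure (pathPart π Q I F p)).Finite :=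
      isCompact_iff_finite.1 (hc.image (continuous_fst.comp (continuous_coe_apply 0)))
    refine infinite_univ (hfin.subset fun k _ => ?_)
    obtain ⟨v, hv, h⟩ := exists_mem_pathPart_eqOn (π := π) (Q := Q) (I := I) (F := F) (q := p)
      (fun _ => (k, π.symm p)) 0 (Or.inr (by simpa)) (by simp) (by simp)
    exact ⟨v, subset_closure hv, by simp [h 0 le_rfl]⟩

theorem isOmegaStone_pathSet : IsOmegaStone (pathSet π Q I F) := by
  have : WeaklyLocallyCompactSpace (pathSet π Q I F) := ⟨fun w => ⟨pathCylinder w 0,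
    isCompact_pathCylinder w 0,
    (isClopen_pathCylinder w 0).isOpen.mem_nhds (mem_pathCylinder_self w 0)⟩⟩
  exact ⟨inferInstance, inferInstance, inferInstance, inferInstance⟩

end PathSpace

/-- (Uniqueness.) Let `P` be a countable poset, `Q` a lower subset of `P`
with a finite foundation, and `I ⊆ P` with `I ∩ P_min ⊆ Q`. Then there is an ω-Stone space
with a trim `P`-partition satisfying (i)–(iii), and any two such are `P`-homeomorphic. -/
theorem existence_and_uniqueness {P : Type*} [PartialOrder P] [Countable P]
    (Q I : Set P) (hQl : IsLowerSet Q)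
    (hQf : ∃ F : Set P, F.Finite ∧ (∀ q ∈ Q, ∀ r ≤ q, ∃ p ∈ F, p ≤ r) ∧
      (∀ p ∈ F, ∃ q ∈ Q, p ≤ q))
    (hIQ : ∀ p ∈ I, IsMin p → p ∈ Q) :
    (∃ (W : Type) (_ : TopologicalSpace W), IsOmegaStone W ∧
      ∃ X : P → Set W, Stmt18Partition Q I X) ∧
    (∀ (W W' : Type) (_ : TopologicalSpace W) (_ : TopologicalSpace W'),
      IsOmegaStone W → IsOmegaStone W' →
      ∀ (X : P → Set W) (X' : P → Set W'),
        Stmt18Partition Q I X → Stmt18Partition Q I X' →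
        ∃ e : W ≃ₜ W', ∀ p, e '' X p = X' p) := by
  obtain ⟨F, hFf, hF, -⟩ := hQf
  obtain ⟨c, hc⟩ := exists_injective_nat P
  refine ⟨⟨pathSet (Equiv.ofInjective c hc).symm Q I F, inferInstance, isOmegaStone_pathSet, _,
    stmt18Partition_pathPart hQl hFf (fun q hq => hF q hq q le_rfl) hIQ⟩, ?_⟩
  intro W W' _ _ hW hW' X X' hX hX'
  have := hW.2.2.1
  have := hW'.2.2.1
  have := hW.2.2.2
  have := hW'.2.2.2
  exact exists_homeomorph_of_stmt18Partition hQl hX hX'
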